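/- Let A ∈ ℂ^{n×n}, v_0 ∈ ℂ^n, and let ℓ ≥ 0 be an integer. Then φ_ℓ applied to the (n+1)×(n+1) block matrix [[A, v_0],[0, 0]] equals the block matrix [[φ_ℓ(A), φ_{ℓ+1}(A)v_0],[0, 1/ℓ!]]. -/

import Mathlib

open Matrix

/-- `φ_j(A) = Σ_{k=0}^∞ A^k / (k+j)!` for a square complex matrix `A`. -/
noncomputable def phi {ι : Type*} [Fintype ι] [DecidableEq ι] (j : ℕ) (A : Matrix ι ι ℂ) :
    Matrix ι ι ℂ :=
  ∑' k : ℕ, ((Nat.factorial (k + j) : ℕ) : ℂ)⁻¹ • A ^ k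

section
attribute [local instance] Matrix.linftyOpNormedRing Matrix.linftyOpNormedAlgebra

/-- The series defining `phi` converges. -/
theorem hasSum_phi {ι : Type*} [Fintype ι] [DecidableEq ι] (j : ℕ) (A : Matrix ι ι ℂ) :
    HasSum (fun k : ℕ => ((Nat.factorial (k + j) : ℕ) : ℂ)⁻¹ • A ^ k) (phi j A) := by
  refine Summable.hasSum (Summable.of_norm_bounded_eventually_nat
    (NormedSpace.norm_expSeries_summable' (𝕂 := ℂ) A) ?_)
  filter_upwards with k
  rw [norm_smul, norm_smul, norm_inv, norm_inv, Complex.norm_natCast, Complex.norm_natCast]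
  gcongr
  exact Nat.le_add_right k j

end

theorem Matrix.fromBlocks_zero_zero_pow_succ {R m p : Type*} [Semiring R] [Fintype m] [Fintype p]
    [DecidableEq m] [DecidableEq p] (A : Matrix m m R) (B : Matrix m p R) (k : ℕ) :
    (Matrix.fromBlocks A B 0 0 : Matrix (m ⊕ p) (m ⊕ p) R) ^ (k + 1) =
      Matrix.fromBlocks (A ^ (k + 1)) (A ^ k * B) 0 0 := by
  induction k with
  | zero => simp
  | succ k ih => rw [pow_succ, ih, Matrix.fromBlocks_multiply]; simp [pow_succ]

theorem HasSum.matrix_fromBlocks {β R m n p q : Type*} [AddCommMonoid R] [TopologicalSpace R]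
    {f : β → Matrix m n R} {g : β → Matrix m q R} {h : β → Matrix p n R} {e : β → Matrix p q R}
    {A : Matrix m n R} {B : Matrix m q R} {C : Matrix p n R} {D : Matrix p q R}
    (hf : HasSum f A) (hg : HasSum g B) (hh : HasSum h C) (he : HasSum e D) :
    HasSum (fun b => Matrix.fromBlocks (f b) (g b) (h b) (e b)) (Matrix.fromBlocks A B C D) := by
  refine Pi.hasSum.2 fun i => Pi.hasSum.2 fun j => ?_
  rcases i with i | i <;> rcases j with j | j
  · exact Pi.hasSum.1 (Pi.hasSum.1 hf i) j
  · exact Pi.hasSum.1 (Pi.hasSum.1 hg i) j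
  · exact Pi.hasSum.1 (Pi.hasSum.1 hh i) j
  · exact Pi.hasSum.1 (Pi.hasSum.1 he i) j

/-- `φ_ℓ` of a block matrix whose lower block row vanishes. -/
theorem phi_fromBlocks_zero_zero {m p : Type*} [Fintype m] [Fintype p]
    [DecidableEq m] [DecidableEq p] (A : Matrix m m ℂ) (B : Matrix m p ℂ) (ℓ : ℕ) :
    phi ℓ (Matrix.fromBlocks A B 0 0) =
      Matrix.fromBlocks (phi ℓ A) (phi (ℓ + 1) A * B) 0
        ((Nat.factorial ℓ : ℂ)⁻¹ • (1 : Matrix p p ℂ)) := by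
  have hA := (hasSum_nat_add_iff' 1).2 (hasSum_phi ℓ A)
  have hB : HasSum (fun k : ℕ => ((Nat.factorial (k + 1 + ℓ) : ℕ) : ℂ)⁻¹ • (A ^ k * B))
      (phi (ℓ + 1) A * B) := by
    have h := (hasSum_phi (ℓ + 1) A).map
      (AddMonoidHom.mk' (fun X : Matrix m m ℂ => X * B) fun X Y => Matrix.add_mul X Y B)
      (continuous_id.matrix_mul continuous_const)
    refine (congrArg (HasSum · (phi (ℓ + 1) A * B)) (funext fun k => ?_)).mpr h
    simp [Matrix.smul_mul, add_assoc, add_comm 1 ℓ]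
  refine (hasSum_phi ℓ _).unique ((hasSum_nat_add_iff' 1).1 ?_)
  convert hA.matrix_fromBlocks hB (hasSum_zero (β := ℕ) (α := Matrix p m ℂ))
    (hasSum_zero (β := ℕ) (α := Matrix p p ℂ)) using 1
  · rfl
  · ext1 k
    rw [Matrix.fromBlocks_zero_zero_pow_succ, Matrix.fromBlocks_smul, smul_zero, smul_zero]
  · rw [Finset.sum_range_one, Finset.sum_range_one, pow_zero, pow_zero, zero_add,
      ← Matrix.fromBlocks_one, Matrix.fromBlocks_smul, sub_eq_add_neg, Matrix.fromBlocks_neg,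
      Matrix.fromBlocks_add]
    simp [sub_eq_add_neg]

/-- For `A ∈ ℂ^{n×n}`, `v₀ ∈ ℂ^n` and `ℓ ≥ 0`,
`φ_ℓ([[A, v₀],[0,0]]) = [[φ_ℓ(A), φ_{ℓ+1}(A)v₀],[0, 1/ℓ!]]`. -/
theorem phi_fromBlocks_single_vector
    (n : ℕ) (A : Matrix (Fin n) (Fin n) ℂ) (v₀ : Fin n → ℂ) (ℓ : ℕ) :
    phi ℓ (Matrix.fromBlocks A (Matrix.of fun i (_ : Fin 1) => v₀ i) 0
        (0 : Matrix (Fin 1) (Fin 1) ℂ)) =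
      Matrix.fromBlocks (phi ℓ A)
        (Matrix.of fun i (_ : Fin 1) => (phi (ℓ + 1) A).mulVec v₀ i) 0
        ((Nat.factorial ℓ : ℂ)⁻¹ • (1 : Matrix (Fin 1) (Fin 1) ℂ)) := by
  exact phi_fromBlocks_zero_zero A _ ℓ
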